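/- Fix χ > 0 with a_2 := w_1 − Σ β_i m_i χ^{2(γ−r_i)} > 0 and 0 < δ < min{H_1, H_2}, and let a_1 = α_0 − h Σ β_i m_i (1+χ^{−2(μ+r_i)}) δ^μ and b_3 = (w_1 + h w_2 + 2h Σ β_i m_i) h. Let Δ > 0 be a root of the equation α_1 Δ^γ + b_3 Δ^{γ+μ} = a_1 δ^γ. Then for every initial function φ with ‖φ‖_H < Δ, every solution x(·,φ) of ẋ(t) = f(x(t), x(t−h)) defined for all t ≥ 0 satisfies ‖x(t,φ)‖_{r,p} → 0 as t → ∞; i.e. the ball {φ : ‖φ‖_H < Δ} is contained in the attraction region of the trivial solution. -/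

import Mathlib

set_option linter.unusedVariables false

noncomputable def hnorm (n : ℕ) (r : Fin n → ℝ) (p : ℝ) (x : Fin n → ℝ) : ℝ :=
  (∑ i, |x i| ^ (p / r i)) ^ (1 / p)

noncomputable def pd (n : ℕ) (f : (Fin n → ℝ) → (Fin n → ℝ) → (Fin n → ℝ))
    (i j : Fin n) (x y : Fin n → ℝ) : ℝ :=
  deriv (fun t => f (Function.update x j t) y i) (x j)

noncomputable def vfun (n : ℕ) (r : Fin n → ℝ) (p h μ γ w1 w2 : ℝ)
    (f : (Fin n → ℝ) → (Fin n → ℝ) → (Fin n → ℝ)) (V : (Fin n → ℝ) → ℝ)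
    (φ : ℝ → Fin n → ℝ) : ℝ :=
  V (φ 0) + fderiv ℝ V (φ 0) (∫ θ in (-h)..(0:ℝ), f (φ 0) (φ θ))
    + ∫ θ in (-h)..(0:ℝ), (w1 + (h + θ) * w2) * hnorm n r p (φ θ) ^ (γ + μ)

noncomputable def segNorm (n : ℕ) (r : Fin n → ℝ) (p h : ℝ)
    (x : ℝ → Fin n → ℝ) (t : ℝ) : ℝ :=
  sSup ((fun θ => hnorm n r p (x (t + θ))) '' Set.Icc (-h) 0)

def IsSol (n : ℕ) (h : ℝ) (f : (Fin n → ℝ) → (Fin n → ℝ) → (Fin n → ℝ))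
    (x : ℝ → Fin n → ℝ) : Prop :=
  ContinuousOn x (Set.Ici (-h)) ∧
  ∀ t : ℝ, 0 ≤ t → HasDerivWithinAt x (f (x t) (x (t - h))) (Set.Ici 0) t


/-- A function whose derivative is nonpositive on the interior of an interval does not increase. -/
lemma le_of_hasDerivAt_nonpos {F F' : ℝ → ℝ} {a b : ℝ} (hab : a ≤ b)
    (hc : ContinuousOn F (Set.Icc a b)) (hd : ∀ t ∈ Set.Ioo a b, HasDerivAt F (F' t) t)
    (hn : ∀ t ∈ Set.Ioo a b, F' t ≤ 0) : F b ≤ F a := by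
  refine antitoneOn_of_deriv_nonpos (convex_Icc a b) hc ?_ ?_ (Set.left_mem_Icc.2 hab)
    (Set.right_mem_Icc.2 hab) hab
  · rw [interior_Icc]
    exact fun t ht => (hd t ht).differentiableAt.differentiableWithinAt
  · rw [interior_Icc]
    intro t ht
    rw [(hd t ht).deriv]
    exact hn t ht

/-- Scalar comparison argument on one delay interval. -/
lemma delay_initial_bound {h S k Q T : ℝ} (hS : 0 ≤ S) {ρ v g : ℝ → ℝ}
    (hv : ContinuousOn v (Set.Ici 0)) (hg : ∀ t, 0 < t → HasDerivAt v (g t) t)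
    (hT : 0 ≤ T) (hTh : T ≤ h) (hQ : ∀ t, -h ≤ t → t < T → ρ t ≤ Q)
    (h1 : ∀ t, 0 < t → t < T → t ≤ h → g t ≤ S * ρ t + k) :
    v T ≤ v 0 + T * (S * Q + k) := by
  have := le_of_hasDerivAt_nonpos (F := fun t => v t - t * (S * Q + k))
    (F' := fun t => g t - 1 * (S * Q + k)) hT
    ((hv.mono Set.Icc_subset_Ici_self).sub (by fun_prop))
    (fun t ht => (hg t ht.1).sub ((hasDerivAt_id t).mul_const _))
    (fun t ht => by
      have a1 := h1 t ht.1 ht.2 (by linarith [ht.2])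
      have a2 := mul_le_mul_of_nonneg_left (hQ t (by linarith [ht.1, ht.2]) ht.2) hS
      linarith)
  simp only [zero_mul, sub_zero] at this
  linarith

section Delay

variable {h E S w k Q q : ℝ} {ρ v g : ℝ → ℝ}

lemma hasDerivAt_primitive (hρ : Continuous ρ) (t : ℝ) :
    HasDerivAt (fun t => ∫ s in (0 : ℝ)..t, ρ s) (ρ t) t :=
  intervalIntegral.integral_hasDerivAt_right (hρ.intervalIntegrable _ _)
    (hρ.stronglyMeasurableAtFilter _ _) hρ.continuousAt

/-- The corrected energy of a delay differential inequality, written with the primitives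
`F` of `ρ` and `K` of `s ↦ s * ρ s`. -/
lemma delay_energy_le (hv : ContinuousOn v (Set.Ici 0))
    (hg : ∀ t, 0 < t → HasDerivAt v (g t) t) {F K : ℝ → ℝ}
    (hF : ∀ t, HasDerivAt F (ρ t) t) (hK : ∀ t, HasDerivAt K (t * ρ t) t)
    {T : ℝ} (hh : 0 < h) (hT : h ≤ T)
    (h2 : ∀ t, h < t → t < T → g t ≤ -w * ρ (t - h) + 2 * h * E * ρ (t - h)
      + 4 * E * (F t - F (t - h)) + 2 * E * (F (t - h) - F (t - 2 * h))) :
    v T - 4 * E * (T * (F T - F (T - h)) - (K T - K (T - h)))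
        + 2 * E * (K (T - h) - K (T - 2 * h) - (T - 2 * h) * (F (T - h) - F (T - 2 * h)))
        + (w - 8 * h * E) * (F (T - h) - F 0)
      ≤ v h - 4 * E * (h * (F h - F 0) - (K h - K 0))
        + 2 * E * (K 0 - K (-h) + h * (F 0 - F (-h))) := by
  have sh : ∀ (G : ℝ → ℝ) (G' : ℝ → ℝ) (c t : ℝ), (∀ t, HasDerivAt G (G' t) t) →
      HasDerivAt (fun t => G (t - c)) (G' (t - c)) t := fun G G' c t hG => by
    simpa using (hG (t - c)).comp_sub_const t c
  have hFc : Continuous F := continuous_iff_continuousAt.2 fun t => (hF t).continuousAt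
  have hKc : Continuous K := continuous_iff_continuousAt.2 fun t => (hK t).continuousAt
  have := le_of_hasDerivAt_nonpos
    (F := fun T => v T - 4 * E * (T * (F T - F (T - h)) - (K T - K (T - h)))
        + 2 * E * (K (T - h) - K (T - 2 * h) - (T - 2 * h) * (F (T - h) - F (T - 2 * h)))
        + (w - 8 * h * E) * (F (T - h) - F 0)) hT
    (by
      have hv' := hv.mono (show Set.Icc h T ⊆ Set.Ici 0 from
        fun t ht => hh.le.trans ht.1)
      fun_prop)
    (fun t ht => (((hg t (hh.trans ht.1)).sub
      ((((hasDerivAt_id t).mul ((hF t).sub (sh F _ h t hF))).sub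
        ((hK t).sub (sh K _ h t hK))).const_mul (4 * E))).add
      ((((sh K _ h t hK).sub (sh K _ (2 * h) t hK)).sub
        (((hasDerivAt_id t).sub_const (2 * h)).mul
          ((sh F _ h t hF).sub (sh F _ (2 * h) t hF)))).const_mul (2 * E))).add
      (((sh F _ h t hF).sub_const (F 0)).const_mul (w - 8 * h * E)))
    (fun t ht => by
      have := h2 t ht.1 ht.2
      simp only [id, Pi.sub_apply]
      linear_combination this)
  have e : h - 2 * h = -h := by ring
  simp only [e, sub_self] at this
  linarith

/-- Weighted integral bounds for the energy of `delay_energy_le`. -/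
lemma delay_weight_le {F K : ℝ → ℝ}
    (hF : ∀ t, HasDerivAt F (ρ t) t) (hK : ∀ t, HasDerivAt K (t * ρ t) t)
    {T : ℝ} (hh : 0 < h) (hQ : ∀ t, T - h ≤ t → t < T → ρ t ≤ Q) :
    T * (F T - F (T - h)) - (K T - K (T - h)) ≤ Q * h ^ 2 / 2 := by
  have hFc : Continuous F := continuous_iff_continuousAt.2 fun t => (hF t).continuousAt
  have hKc : Continuous K := continuous_iff_continuousAt.2 fun t => (hK t).continuousAt
  have := le_of_hasDerivAt_nonpos (a := T - h) (b := T)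
    (F := fun u => T * F u - K u + Q / 2 * (T - u) ^ 2) (by linarith)
    (by fun_prop)
    (fun u hu => (((hF u).const_mul T).sub (hK u)).add
      ((((hasDerivAt_id u).const_sub T).pow 2).const_mul (Q / 2)))
    (fun u hu => by
      have := mul_nonneg (sub_nonneg.2 hu.2.le) (sub_nonneg.2 (hQ u hu.1.le hu.2))
      simp only [id]
      norm_num
      linarith)
  simp only [sub_self] at this
  nlinarith

lemma delay_weight_nonneg {F K : ℝ → ℝ}
    (hF : ∀ t, HasDerivAt F (ρ t) t) (hK : ∀ t, HasDerivAt K (t * ρ t) t)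
    {T : ℝ} (hh : 0 < h) (hQ : ∀ t, 0 ≤ ρ t) :
    0 ≤ K (T - h) - K (T - 2 * h) - (T - 2 * h) * (F (T - h) - F (T - 2 * h)) := by
  have hFc : Continuous F := continuous_iff_continuousAt.2 fun t => (hF t).continuousAt
  have hKc : Continuous K := continuous_iff_continuousAt.2 fun t => (hK t).continuousAt
  have := le_of_hasDerivAt_nonpos (a := T - 2 * h) (b := T - h)
    (F := fun u => (T - 2 * h) * F u - K u) (by linarith)
    (by fun_prop)
    (fun u hu => ((hF u).const_mul (T - 2 * h)).sub (hK u))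
    (fun u hu => by
      have := mul_nonneg (sub_nonneg.2 hu.1.le) (hQ u)
      linarith)
  linarith

lemma delay_initial_weight_le {F K : ℝ → ℝ}
    (hF : ∀ t, HasDerivAt F (ρ t) t) (hK : ∀ t, HasDerivAt K (t * ρ t) t)
    (hh : 0 < h) (hq : ∀ t, -h ≤ t → t ≤ 0 → ρ t ≤ q) :
    K 0 - K (-h) + h * (F 0 - F (-h)) ≤ q * h ^ 2 / 2 := by
  have hFc : Continuous F := continuous_iff_continuousAt.2 fun t => (hF t).continuousAt
  have hKc : Continuous K := continuous_iff_continuousAt.2 fun t => (hK t).continuousAt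
  have := le_of_hasDerivAt_nonpos (a := -h) (b := 0)
    (F := fun u => K u + h * F u - q / 2 * (u + h) ^ 2) (by linarith)
    (by fun_prop)
    (fun u hu => ((hK u).add ((hF u).const_mul h)).sub
      ((((hasDerivAt_id u).add_const h).pow 2).const_mul (q / 2)))
    (fun u hu => by
      have := mul_nonneg (sub_nonneg.2 hu.1.le) (sub_nonneg.2 (hq u hu.1.le hu.2.le))
      simp only [id]
      norm_num
      linarith)
  simp only [neg_add_cancel] at this
  nlinarith

lemma delay_first_interval_le (hv : ContinuousOn v (Set.Ici 0))
    (hg : ∀ t, 0 < t → HasDerivAt v (g t) t) {F K : ℝ → ℝ}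
    (hF : ∀ t, HasDerivAt F (ρ t) t) (hK : ∀ t, HasDerivAt K (t * ρ t) t)
    (hh : 0 < h) (hE : 0 ≤ E) (hSE : 4 * h * E ≤ S)
    (hQ : ∀ t, 0 < t → t < h → ρ t ≤ Q)
    (h1 : ∀ t, 0 < t → t < h → g t ≤ S * ρ t + k) :
    v h - 4 * E * (h * (F h - F 0) - (K h - K 0))
      ≤ v 0 + h * (S * Q + k) - 2 * E * h ^ 2 * Q := by
  have hFc : Continuous F := continuous_iff_continuousAt.2 fun t => (hF t).continuousAt
  have hKc : Continuous K := continuous_iff_continuousAt.2 fun t => (hK t).continuousAt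
  have := le_of_hasDerivAt_nonpos (a := 0) (b := h)
    (F := fun u => v u - 4 * E * (h * F u - K u) - u * (S * Q + k)
      - 2 * E * Q * (h - u) ^ 2) hh.le
    (by
      have hv' := hv.mono (show Set.Icc 0 h ⊆ Set.Ici 0 from fun t ht => ht.1)
      fun_prop)
    (fun u hu => (((hg u hu.1).sub (((((hF u).const_mul h)).sub (hK u)).const_mul (4 * E))).sub
      ((hasDerivAt_id u).mul_const (S * Q + k))).sub
      ((((hasDerivAt_id u).const_sub h).pow 2).const_mul (2 * E * Q)))
    (fun u hu => by
      have a1 := h1 u hu.1 hu.2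
      have a2 : 0 ≤ S - 4 * E * (h - u) := by nlinarith [mul_nonneg hE hu.1.le]
      have := mul_nonneg a2 (sub_nonneg.2 (hQ u hu.1 hu.2))
      simp only [id]
      norm_num
      linarith)
  linarith

end Delay

/-- Bound for solutions of a scalar delay differential inequality, up to time `T`, together with
the integral of the dissipated quantity. -/
lemma delay_bound {h E S w k Q q T : ℝ} {ρ v g : ℝ → ℝ} (hρ : Continuous ρ)
    (hρ0 : ∀ t, 0 ≤ ρ t) (hv : ContinuousOn v (Set.Ici 0))
    (hg : ∀ t, 0 < t → HasDerivAt v (g t) t)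
    (hh : 0 < h) (hE : 0 ≤ E) (hSE : 4 * h * E ≤ S) (hT : h ≤ T)
    (hQ : ∀ t, -h ≤ t → t < T → ρ t ≤ Q) (hq : ∀ t, -h ≤ t → t ≤ 0 → ρ t ≤ q)
    (h1 : ∀ t, 0 < t → t < T → t ≤ h → g t ≤ S * ρ t + k)
    (h2 : ∀ t, h < t → t < T → g t ≤ -w * ρ (t - h) + 2 * h * E * ρ (t - h)
      + 4 * E * ((∫ s in (0 : ℝ)..t, ρ s) - ∫ s in (0 : ℝ)..(t - h), ρ s)
      + 2 * E * ((∫ s in (0 : ℝ)..(t - h), ρ s) - ∫ s in (0 : ℝ)..(t - 2 * h), ρ s)) :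
    v T + (w - 8 * h * E) * (∫ s in (0 : ℝ)..(T - h), ρ s)
      ≤ v 0 + h * (S * Q + k) + E * h ^ 2 * q := by
  set F : ℝ → ℝ := fun t => ∫ s in (0 : ℝ)..t, ρ s with hFdef
  set K : ℝ → ℝ := fun t => ∫ s in (0 : ℝ)..t, s * ρ s with hKdef
  have hF : ∀ t, HasDerivAt F (ρ t) t := hasDerivAt_primitive hρ
  have hK : ∀ t, HasDerivAt K (t * ρ t) t := hasDerivAt_primitive (continuous_id.mul hρ)
  have F0 : F 0 = 0 := by simp [hFdef]
  have b1 := delay_energy_le (w := w) (E := E) hv hg hF hK hh hT h2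
  have b2 := delay_weight_le (Q := Q) (T := T) hF hK hh fun t ht ht' => hQ t (by linarith) ht'
  have b3 := delay_weight_nonneg (T := T) hF hK hh hρ0
  have b4 := delay_initial_weight_le hF hK hh hq
  have b5 := delay_first_interval_le (E := E) hv hg hF hK hh hE hSE
    (fun t ht ht' => hQ t (by linarith) (by linarith))
    (fun t ht ht' => h1 t ht (by linarith) ht'.le)
  have c2 := mul_le_mul_of_nonneg_left b2 hE
  have c3 := mul_nonneg hE b3
  have c4 := mul_le_mul_of_nonneg_left b4 hE
  rw [F0, sub_zero] at b1
  change v T + (w - 8 * h * E) * F (T - h) ≤ _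
  rw [F0] at b5 c4
  linarith

/-- If `v` decreases at most at a bounded rate from above, is nonnegative, and is controlled by an
integrable quantity, then it tends to zero. -/
lemma tendsto_zero_of_integral_bounded {ρ v g : ℝ → ℝ} {B M : ℝ} (hρ : Continuous ρ)
    (hρ0 : ∀ t, 0 ≤ ρ t) (hv0 : ∀ t, 0 ≤ v t)
    (hg : ∀ t, 0 < t → HasDerivAt v (g t) t) (hB : 0 < B) (hgB : ∀ t, 0 < t → g t ≤ B)
    (hM : ∀ t, 0 ≤ t → ∫ s in (0 : ℝ)..t, ρ s ≤ M)
    (hvρ : ∀ ε, 0 < ε → ∃ c, 0 < c ∧ ∀ t, 0 < t → ε ≤ v t → c ≤ ρ t) :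
    Filter.Tendsto v Filter.atTop (nhds 0) := by
  set F : ℝ → ℝ := fun t => ∫ s in (0 : ℝ)..t, ρ s with hFdef
  have hF : ∀ t, HasDerivAt F (ρ t) t := hasDerivAt_primitive hρ
  have hFc : Continuous F := continuous_iff_continuousAt.2 fun t => (hF t).continuousAt
  have hmono : Monotone F := monotone_of_hasDerivAt_nonneg hF hρ0
  have hbdd : BddAbove (Set.range F) := ⟨M, by
    rintro _ ⟨t, rfl⟩
    exact (hmono (le_max_left t 0)).trans (hM _ (le_max_right t 0))⟩
  have hlim := tendsto_atTop_ciSup hmono hbdd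
  rw [Metric.tendsto_atTop]
  intro ε hε
  obtain ⟨c, hc, hcρ⟩ := hvρ (ε / 2) (by positivity)
  set κ := ε / (2 * B) with hκ
  have hκ0 : 0 < κ := by positivity
  have hκB : κ * B = ε / 2 := by rw [hκ]; field_simp
  have hdiff : Filter.Tendsto (fun t => F t - F (t - κ)) Filter.atTop (nhds 0) := by
    have := hlim.sub (hlim.comp (Filter.tendsto_atTop_add_const_right _ (-κ) Filter.tendsto_id))
    simpa [sub_eq_add_neg] using this
  obtain ⟨N, hN⟩ := Filter.eventually_atTop.1
    (hdiff.eventually (gt_mem_nhds (show 0 < κ * c by positivity)))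
  refine ⟨max N (κ + 1), fun t ht => ?_⟩
  have htN := (le_max_left _ _).trans ht
  have htκ := (le_max_right _ _).trans ht
  rw [Real.dist_eq, sub_zero, abs_of_nonneg (hv0 t)]
  by_contra! hcon
  have hlow : ∀ s ∈ Set.Ioo (t - κ) t, c ≤ ρ s := fun s hs => by
    have hs0 : 0 < s := by linarith [hs.1]
    refine hcρ s hs0 ?_
    have := le_of_hasDerivAt_nonpos (a := s) (b := t) (F := fun u => v u - u * B) hs.2.le
      (fun u hu => ((hg u (hs0.trans_le hu.1)).continuousAt.sub
        (by fun_prop)).continuousWithinAt)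
      (fun u hu => (hg u (hs0.trans hu.1)).sub ((hasDerivAt_id u).mul_const B))
      (fun u hu => by linarith [hgB u (hs0.trans hu.1)])
    have h3 := mul_le_mul_of_nonneg_right (show t - s ≤ κ by linarith [hs.1]) hB.le
    linarith
  have := le_of_hasDerivAt_nonpos (a := t - κ) (b := t) (F := fun u => u * c - F u)
    (by linarith) (by fun_prop)
    (fun u hu => ((hasDerivAt_id u).mul_const c).sub (hF u))
    (fun u hu => by linarith [hlow u hu])
  have := hN t htN
  linarith

lemma hnorm_nonneg (n : ℕ) (r : Fin n → ℝ) (p : ℝ) (x : Fin n → ℝ) : 0 ≤ hnorm n r p x :=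
  Real.rpow_nonneg (Finset.sum_nonneg fun _ _ => Real.rpow_nonneg (abs_nonneg _) _) _

lemma continuous_hnorm (n : ℕ) {r : Fin n → ℝ} (hr : ∀ i, 0 < r i) {p : ℝ} (hp : 0 < p) :
    Continuous (hnorm n r p) := by
  have : ∀ i, 0 ≤ p / r i := fun i => (div_pos hp (hr i)).le
  refine Continuous.rpow_const (continuous_finsetSum _ fun i _ => ?_)
    fun _ => Or.inr (by positivity)
  exact ((continuous_apply i).abs).rpow_const fun _ => Or.inr (this i)

lemma hnorm_one_pos {n : ℕ} (hn : 1 ≤ n) (r : Fin n → ℝ) (p : ℝ) :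
    0 < hnorm n r p (fun _ => 1) := by
  have : (0 : ℝ) < n := by exact_mod_cast hn
  simp only [hnorm, abs_one, Real.one_rpow, Finset.sum_const, Finset.card_univ, Fintype.card_fin,
    nsmul_eq_mul, mul_one]
  positivity

/-- A trilinear monomial of total degree `A + μ` is bounded by `δ ^ μ` times the sum of the
`A`-th powers. -/
lemma rpow_mul_rpow_mul_rpow_le {a M e₁ e₂ e₃ A μ δ : ℝ} {b c : ℝ} (ha : 0 ≤ a) (hb : 0 ≤ b)
    (hc : 0 ≤ c) (haM : a ≤ M) (hbM : b ≤ M) (hcM : c ≤ M) (hM : M ≤ δ)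
    (h₁ : 0 ≤ e₁) (h₂ : 0 ≤ e₂) (h₃ : 0 ≤ e₃) (hA : 0 ≤ A) (hμ : 0 ≤ μ)
    (he : e₁ + e₂ + e₃ = A + μ) :
    a ^ e₁ * b ^ e₂ * c ^ e₃ ≤ δ ^ μ * M ^ A := by
  have hM0 : 0 ≤ M := ha.trans haM
  calc a ^ e₁ * b ^ e₂ * c ^ e₃ ≤ M ^ e₁ * M ^ e₂ * M ^ e₃ := by gcongr
    _ = M ^ μ * M ^ A := by
        rw [← Real.rpow_add_of_nonneg hM0 h₁ h₂,
          ← Real.rpow_add_of_nonneg hM0 (add_nonneg h₁ h₂) h₃,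
          ← Real.rpow_add_of_nonneg hM0 hμ hA, he, add_comm]
    _ ≤ δ ^ μ * M ^ A := by gcongr

lemma rpow_mul_add_mul_add_le {a b c e₁ e₂ e₃ A μ δ : ℝ} (ha : 0 ≤ a) (hb : 0 ≤ b)
    (hc : 0 ≤ c) (haδ : a ≤ δ) (hbδ : b ≤ δ) (hcδ : c ≤ δ)
    (h₁ : 0 ≤ e₁) (h₂ : 0 ≤ e₂) (h₃ : 0 ≤ e₃) (hA : 0 ≤ A) (hμ : 0 ≤ μ)
    (he : e₁ + e₂ + e₃ = A + μ) :
    a ^ e₁ * (a ^ e₂ + b ^ e₂) * (a ^ e₃ + c ^ e₃)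
      ≤ δ ^ μ * (4 * a ^ A + 2 * b ^ A + 2 * c ^ A) := by
  have hδ : 0 ≤ δ ^ μ := Real.rpow_nonneg (ha.trans haδ) _
  have pa := Real.rpow_nonneg ha A
  have pb := Real.rpow_nonneg hb A
  have pc := Real.rpow_nonneg hc A
  have hmax : ∀ x y : ℝ, 0 ≤ x → 0 ≤ y → max x y ^ A ≤ x ^ A + y ^ A := fun x y hx hy => by
    rcases max_choice x y with h | h <;> rw [h]
    · linarith [Real.rpow_nonneg hy A]
    · linarith [Real.rpow_nonneg hx A]
  have t1 := rpow_mul_rpow_mul_rpow_le ha ha ha le_rfl le_rfl le_rfl haδ h₁ h₂ h₃ hA hμ he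
  have t2 := rpow_mul_rpow_mul_rpow_le ha ha hc (le_max_left a c) (le_max_left a c)
    (le_max_right a c) (max_le haδ hcδ) h₁ h₂ h₃ hA hμ he
  have t3 := rpow_mul_rpow_mul_rpow_le ha hb ha (le_max_left a b) (le_max_right a b)
    (le_max_left a b) (max_le haδ hbδ) h₁ h₂ h₃ hA hμ he
  have t4 := rpow_mul_rpow_mul_rpow_le ha hb hc ((le_max_left a b).trans (le_max_left _ c))
    ((le_max_right a b).trans (le_max_left _ c)) (le_max_right _ c)
    (max_le (max_le haδ hbδ) hcδ) h₁ h₂ h₃ hA hμ he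
  have s2 := mul_le_mul_of_nonneg_left (hmax a c ha hc) hδ
  have s3 := mul_le_mul_of_nonneg_left (hmax a b ha hb) hδ
  have s4 := mul_le_mul_of_nonneg_left (hmax (max a b) c (le_max_of_le_left ha) hc) hδ
  have s5 := mul_le_mul_of_nonneg_left (hmax a b ha hb) hδ
  nlinarith

/-- A weighted Young-type inequality without constants. -/
lemma rpow_mul_rpow_le_young {d D χ a b : ℝ} (hd : 0 < d) (hD : 0 < D) (hχ : 0 < χ)
    (ha : 0 ≤ a) (hb : 0 ≤ b) :
    d ^ a * D ^ b ≤ χ ^ (-2 * b) * d ^ (a + b) + χ ^ (2 * a) * D ^ (a + b) := by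
  rw [Real.rpow_add hd, Real.rpow_add hD, Real.rpow_mul hχ.le, Real.rpow_mul hχ.le]
  have hz : χ ^ (-2 : ℝ) = (χ ^ (2 : ℝ))⁻¹ := Real.rpow_neg hχ.le 2
  rw [hz]
  have hz0 : 0 < χ ^ (2 : ℝ) := Real.rpow_pos_of_pos hχ _
  set z := χ ^ (2 : ℝ)
  have pda := Real.rpow_pos_of_pos hd a
  have pdb := Real.rpow_pos_of_pos hd b
  have pDa := Real.rpow_pos_of_pos hD a
  have pDb := Real.rpow_pos_of_pos hD b
  have pz := Real.rpow_pos_of_pos hz0 a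
  have pz' := Real.rpow_pos_of_pos (inv_pos.2 hz0) b
  rcases le_total D (z⁻¹ * d) with h | h
  · have : D ^ b ≤ z⁻¹ ^ b * d ^ b := by
      rw [← Real.mul_rpow (inv_pos.2 hz0).le hd.le]
      exact Real.rpow_le_rpow hD.le h hb
    calc d ^ a * D ^ b ≤ d ^ a * (z⁻¹ ^ b * d ^ b) := by gcongr
      _ = z⁻¹ ^ b * (d ^ a * d ^ b) := by ring
      _ ≤ _ := le_add_of_nonneg_right (by positivity)
  · have h' : d ≤ z * D := by
      rw [inv_mul_le_iff₀ hz0] at h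
      exact h
    have : d ^ a ≤ z ^ a * D ^ a := by
      rw [← Real.mul_rpow hz0.le hD.le]
      exact Real.rpow_le_rpow hd.le h' ha
    calc d ^ a * D ^ b ≤ (z ^ a * D ^ a) * D ^ b := by gcongr
      _ = z ^ a * (D ^ a * D ^ b) := by ring
      _ ≤ _ := le_add_of_nonneg_left (by positivity)

lemma fderiv_apply_eq_sum {n : ℕ} (ℓ : (Fin n → ℝ) →L[ℝ] ℝ) (v : Fin n → ℝ) :
    ℓ v = ∑ i, v i * ℓ (Pi.single i 1) := by
  have := LinearMap.pi_apply_eq_sum_univ (ℓ : (Fin n → ℝ) →ₗ[ℝ] ℝ) v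
  simp only [ContinuousLinearMap.coe_coe, smul_eq_mul] at this
  rw [this]
  refine Finset.sum_congr rfl fun i _ => ?_
  congr 2
  ext j
  simp [Pi.single_apply, eq_comm]

lemma pd_eq_fderiv {n : ℕ} {f : (Fin n → ℝ) → (Fin n → ℝ) → (Fin n → ℝ)} {x y : Fin n → ℝ}
    (i j : Fin n) (hf : DifferentiableAt ℝ (fun z => f z y i) x) :
    pd n f i j x y = fderiv ℝ (fun z => f z y i) x (Pi.single j 1) := by
  have h1 : HasDerivAt (Function.update x j) (Pi.single j (1 : ℝ)) (x j) := hasDerivAt_update x j _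
  have h2 : HasFDerivAt (fun z => f z y i) (fderiv ℝ (fun z => f z y i) x)
      (Function.update x j (x j)) := by
    rw [Function.update_eq_self]
    exact hf.hasFDerivAt
  exact (h2.comp_hasDerivAt (x j) h1).deriv

/-- Derivative along a curve of the directional derivative of `V` in the direction of `f`, with the
second argument of `f` frozen. -/
lemma hasDerivAt_fderiv_apply {n : ℕ} {f : (Fin n → ℝ) → (Fin n → ℝ) → (Fin n → ℝ)}
    (hf : ∀ y : Fin n → ℝ, ContDiff ℝ 1 fun x => f x y) {V : (Fin n → ℝ) → ℝ}
    (hV : ContDiff ℝ 2 V) (y : Fin n → ℝ) {X : ℝ → Fin n → ℝ} {v : Fin n → ℝ} {s : ℝ}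
    (hX : HasDerivAt X v s) :
    HasDerivAt (fun s => fderiv ℝ V (X s) (f (X s) y))
      (∑ i, ∑ j, v j * (fderiv ℝ V (X s) (Pi.single i 1) * pd n f i j (X s) y
        + f (X s) y i * fderiv ℝ (fun z => fderiv ℝ V z (Pi.single i 1)) (X s)
          (Pi.single j 1))) s := by
  have hfi : ∀ i, Differentiable ℝ fun z => f z y i := fun i =>
    differentiable_pi.1 ((hf y).differentiable (by norm_num)) i
  have hVi : ∀ i, Differentiable ℝ fun z => fderiv ℝ V z (Pi.single i 1) := fun i =>
    ((hV.fderiv_right (m := 1) (by norm_num)).differentiable (by norm_num)).clm_apply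
      (differentiable_const _)
  have hfun : (fun s => fderiv ℝ V (X s) (f (X s) y))
      = fun s => ∑ i, f (X s) y i * fderiv ℝ V (X s) (Pi.single i 1) :=
    funext fun s => fderiv_apply_eq_sum _ _
  rw [hfun]
  refine HasDerivAt.fun_sum fun i _ => ?_
  have h1 := ((hfi i (X s)).hasFDerivAt.comp_hasDerivAt s hX).mul
    ((hVi i (X s)).hasFDerivAt.comp_hasDerivAt s hX)
  refine h1.congr_deriv ?_
  rw [fderiv_apply_eq_sum (fderiv ℝ (fun z => f z y i) (X s)) v,
    fderiv_apply_eq_sum (fderiv ℝ (fun z => fderiv ℝ V z (Pi.single i 1)) (X s)) v,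
    Finset.sum_mul, Finset.mul_sum, ← Finset.sum_add_distrib]
  refine Finset.sum_congr rfl fun j _ => ?_
  rw [pd_eq_fderiv i j (hfi i (X s))]
  simp only [Function.comp_apply]
  ring

/-- Bound on the second-order term in the derivative of the Lyapunov function. -/
lemma abs_second_order_le {n : ℕ} {r : Fin n → ℝ} (hr : ∀ i, 0 < r i) {p μ γ δ : ℝ} (hμ : 0 < μ)
    (hδ0 : 0 < δ) {f : (Fin n → ℝ) → (Fin n → ℝ) → (Fin n → ℝ)}
    {m : Fin n → ℝ} (hm : ∀ i, 0 < m i)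
    (hfm : ∀ x y : Fin n → ℝ, ∀ i,
      |f x y i| ≤ m i * (hnorm n r p x ^ (μ + r i) + hnorm n r p y ^ (μ + r i)))
    {η : Fin n → Fin n → ℝ} (hη : ∀ i j, 0 < η i j)
    (hfd1 : ∀ i j, 0 ≤ μ + r i - r j → ∀ x y : Fin n → ℝ,
      |pd n f i j x y| ≤ η i j * (hnorm n r p x ^ (μ + r i - r j) + hnorm n r p y ^ (μ + r i - r j)))
    (hfd2 : ∀ i j, μ + r i - r j < 0 → ∀ x y : Fin n → ℝ, |pd n f i j x y| ≤ η i j)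
    {V : (Fin n → ℝ) → ℝ} (hγ : ∀ i, 2 * r i ≤ γ)
    {β : Fin n → ℝ} (hβ : ∀ i, 0 < β i)
    (hVd : ∀ x : Fin n → ℝ, ∀ i,
      |fderiv ℝ V x (Pi.single i 1)| ≤ β i * hnorm n r p x ^ (γ - r i))
    {ψ : Fin n → Fin n → ℝ} (hψ : ∀ i j, 0 < ψ i j)
    (hVdd : ∀ x : Fin n → ℝ, ∀ i j,
      |fderiv ℝ (fun z => fderiv ℝ V z (Pi.single i 1)) x (Pi.single j 1)|
        ≤ ψ i j * hnorm n r p x ^ (γ - r i - r j))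
    {z y u : Fin n → ℝ} (hz : hnorm n r p z ≤ δ) (hy : hnorm n r p y ≤ δ)
    (hu : hnorm n r p u ≤ δ) :
    |∑ i, ∑ j, f z u j * (fderiv ℝ V z (Pi.single i 1) * pd n f i j z y
        + f z y i * fderiv ℝ (fun z => fderiv ℝ V z (Pi.single i 1)) z (Pi.single j 1))|
      ≤ (∑ i, ∑ j, m j * (β i * η i j *
          (if 0 ≤ μ + r i - r j then 1 else δ ^ (r j - r i - μ)) + m i * ψ i j)) * δ ^ μ
        * (4 * hnorm n r p z ^ (γ + μ) + 2 * hnorm n r p y ^ (γ + μ)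
          + 2 * hnorm n r p u ^ (γ + μ)) := by
  have ha := hnorm_nonneg n r p z
  have hb := hnorm_nonneg n r p y
  have hc := hnorm_nonneg n r p u
  set a := hnorm n r p z with ha_def
  set b := hnorm n r p y with hb_def
  set c := hnorm n r p u with hc_def
  set N := 4 * a ^ (γ + μ) + 2 * b ^ (γ + μ) + 2 * c ^ (γ + μ) with hN
  rw [mul_assoc, Finset.sum_mul]
  refine (Finset.abs_sum_le_sum_abs _ _).trans (Finset.sum_le_sum fun i _ => ?_)
  rw [Finset.sum_mul]
  refine (Finset.abs_sum_le_sum_abs _ _).trans (Finset.sum_le_sum fun j _ => ?_)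
  have hi := hr i
  have hj := hr j
  have hγi := hγ i
  have hγj := hγ j
  have hc0 : 0 ≤ a ^ (μ + r j) + c ^ (μ + r j) := by positivity
  have key1 : a ^ (γ - r i) * |pd n f i j z y| * (a ^ (μ + r j) + c ^ (μ + r j))
      ≤ η i j * (if 0 ≤ μ + r i - r j then 1 else δ ^ (r j - r i - μ)) * (δ ^ μ * N) := by
    split_ifs with hs
    · have := rpow_mul_add_mul_add_le (e₁ := γ - r i) (e₂ := μ + r i - r j) (e₃ := μ + r j)
        (A := γ + μ) (μ := μ) ha hb hc hz hy hu (by linarith) hs (by linarith) (by linarith)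
        hμ.le (by ring)
      calc a ^ (γ - r i) * |pd n f i j z y| * (a ^ (μ + r j) + c ^ (μ + r j))
          ≤ a ^ (γ - r i) * (η i j * (a ^ (μ + r i - r j) + b ^ (μ + r i - r j)))
              * (a ^ (μ + r j) + c ^ (μ + r j)) := by
            gcongr
            exact hfd1 i j hs z y
        _ = η i j * (a ^ (γ - r i) * (a ^ (μ + r i - r j) + b ^ (μ + r i - r j))
              * (a ^ (μ + r j) + c ^ (μ + r j))) := by ring
        _ ≤ η i j * (δ ^ μ * N) := mul_le_mul_of_nonneg_left this (hη i j).le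
        _ = _ := by ring
    · push Not at hs
      have := rpow_mul_add_mul_add_le (e₁ := γ - r i) (e₂ := 0) (e₃ := μ + r j)
        (A := γ + μ) (μ := μ + (r j - r i - μ)) ha hb hc hz hy hu (by linarith) le_rfl
        (by linarith) (by linarith) (by linarith) (by ring)
      rw [Real.rpow_zero, Real.rpow_zero, Real.rpow_add hδ0] at this
      have h0 : 0 ≤ a ^ (γ - r i) * (a ^ (μ + r j) + c ^ (μ + r j)) := by positivity
      calc a ^ (γ - r i) * |pd n f i j z y| * (a ^ (μ + r j) + c ^ (μ + r j))
          ≤ a ^ (γ - r i) * η i j * (a ^ (μ + r j) + c ^ (μ + r j)) := by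
            gcongr
            exact hfd2 i j hs z y
        _ = η i j * (a ^ (γ - r i) * (a ^ (μ + r j) + c ^ (μ + r j))) := by ring
        _ ≤ η i j * (δ ^ μ * δ ^ (r j - r i - μ) * N) :=
            mul_le_mul_of_nonneg_left (by linarith) (hη i j).le
        _ = _ := by ring
  have key2 : a ^ (γ - r i - r j) * (a ^ (μ + r i) + b ^ (μ + r i))
      * (a ^ (μ + r j) + c ^ (μ + r j)) ≤ δ ^ μ * N :=
    rpow_mul_add_mul_add_le ha hb hc hz hy hu (by linarith) (by linarith) (by linarith)
      (by linarith) hμ.le (by ring)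
  have hmj := hm j
  have hmi := hm i
  have hβi := hβ i
  have hψi := hψ i j
  calc |f z u j * (fderiv ℝ V z (Pi.single i 1) * pd n f i j z y
        + f z y i * fderiv ℝ (fun z => fderiv ℝ V z (Pi.single i 1)) z (Pi.single j 1))|
      ≤ |f z u j| * (|fderiv ℝ V z (Pi.single i 1)| * |pd n f i j z y|
        + |f z y i| * |fderiv ℝ (fun z => fderiv ℝ V z (Pi.single i 1)) z (Pi.single j 1)|) := by
        refine (abs_mul _ _).trans_le
          (mul_le_mul_of_nonneg_left ((abs_add_le _ _).trans_eq ?_) (abs_nonneg _))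
        rw [abs_mul, abs_mul]
    _ ≤ (m j * (a ^ (μ + r j) + c ^ (μ + r j))) * ((β i * a ^ (γ - r i)) * |pd n f i j z y|
        + (m i * (a ^ (μ + r i) + b ^ (μ + r i))) * (ψ i j * a ^ (γ - r i - r j))) := by
        gcongr
        · exact hfm z u j
        · exact hVd z i
        · exact hfm z y i
        · exact hVdd z i j
    _ = m j * (β i * (a ^ (γ - r i) * |pd n f i j z y| * (a ^ (μ + r j) + c ^ (μ + r j)))
        + m i * ψ i j * (a ^ (γ - r i - r j) * (a ^ (μ + r i) + b ^ (μ + r i))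
          * (a ^ (μ + r j) + c ^ (μ + r j)))) := by ring
    _ ≤ m j * (β i * (η i j * (if 0 ≤ μ + r i - r j then 1 else δ ^ (r j - r i - μ))
          * (δ ^ μ * N)) + m i * ψ i j * (δ ^ μ * N)) := by gcongr
    _ = _ := by ring

/-- First-order bound on the derivative of the Lyapunov function. -/
lemma abs_fderiv_apply_le {n : ℕ} {r : Fin n → ℝ} {p μ γ : ℝ}
    {f : (Fin n → ℝ) → (Fin n → ℝ) → (Fin n → ℝ)} {m : Fin n → ℝ} (hm : ∀ i, 0 < m i)
    (hfm : ∀ x y : Fin n → ℝ, ∀ i,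
      |f x y i| ≤ m i * (hnorm n r p x ^ (μ + r i) + hnorm n r p y ^ (μ + r i)))
    {V : (Fin n → ℝ) → ℝ} {β : Fin n → ℝ}
    (hVd : ∀ x : Fin n → ℝ, ∀ i,
      |fderiv ℝ V x (Pi.single i 1)| ≤ β i * hnorm n r p x ^ (γ - r i)) (z y : Fin n → ℝ) :
    |fderiv ℝ V z (f z y)| ≤ ∑ i, β i * m i * (hnorm n r p z ^ (γ - r i)
      * (hnorm n r p z ^ (μ + r i) + hnorm n r p y ^ (μ + r i))) := by
  rw [fderiv_apply_eq_sum]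
  refine (Finset.abs_sum_le_sum_abs _ _).trans (Finset.sum_le_sum fun i _ => ?_)
  have h1 := Real.rpow_nonneg (hnorm_nonneg n r p z) (μ + r i)
  have h2 := Real.rpow_nonneg (hnorm_nonneg n r p y) (μ + r i)
  have h3 := (hm i).le
  rw [abs_mul]
  calc _ ≤ (m i * (hnorm n r p z ^ (μ + r i) + hnorm n r p y ^ (μ + r i)))
        * (β i * hnorm n r p z ^ (γ - r i)) := by
        gcongr
        · exact hfm z y i
        · exact hVd z i
    _ = _ := by ring

/-- Sum form of the crude bound in terms of separate bounds `d`, `D` on the two arguments. -/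
lemma sum_rpow_mul_add_le {n : ℕ} {r β m : Fin n → ℝ} {μ γ χ a b d D : ℝ} (hr : ∀ i, 0 < r i)
    (hμ : 0 < μ) (hγ : ∀ i, 2 * r i ≤ γ) (hm : ∀ i, 0 < m i) (hβ : ∀ i, 0 < β i) (hχ : 0 < χ)
    (ha : 0 ≤ a) (hb : 0 ≤ b) (hd : 0 < d) (hD : 0 < D) (had : a ≤ d) (hbD : b ≤ D) :
    ∑ i, β i * m i * (a ^ (γ - r i) * (a ^ (μ + r i) + b ^ (μ + r i)))
      ≤ (∑ i, β i * m i) * a ^ (γ + μ) + ((∑ i, β i * m i * χ ^ (-2 * (μ + r i))) * d ^ (γ + μ)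
        + (∑ i, β i * m i * χ ^ (2 * (γ - r i))) * D ^ (γ + μ)) := by
  simp only [Finset.sum_mul, ← Finset.sum_add_distrib]
  refine Finset.sum_le_sum fun i _ => ?_
  have hi := hr i
  have hγi := hγ i
  have h1 := rpow_mul_rpow_le_young hd hD hχ (show 0 ≤ γ - r i by linarith)
    (show 0 ≤ μ + r i by linarith)
  have e : γ - r i + (μ + r i) = γ + μ := by ring
  rw [e] at h1
  have h2 : a ^ (γ - r i) * b ^ (μ + r i) ≤ d ^ (γ - r i) * D ^ (μ + r i) := by
    have : 0 ≤ γ - r i := by linarith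
    gcongr
  have h3 : a ^ (γ - r i) * a ^ (μ + r i) = a ^ (γ + μ) := by
    rw [← Real.rpow_add_of_nonneg ha (by linarith) (by linarith), e]
  have h4 : a ^ (γ - r i) * (a ^ (μ + r i) + b ^ (μ + r i)) ≤ a ^ (γ + μ)
      + (χ ^ (-2 * (μ + r i)) * d ^ (γ + μ) + χ ^ (2 * (γ - r i)) * D ^ (γ + μ)) := by
    rw [mul_add, h3]
    linarith
  calc _ ≤ β i * m i * (a ^ (γ + μ)
      + (χ ^ (-2 * (μ + r i)) * d ^ (γ + μ) + χ ^ (2 * (γ - r i)) * D ^ (γ + μ))) :=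
        mul_le_mul_of_nonneg_left h4 (mul_pos (hβ i) (hm i)).le
    _ = _ := by ring

/-- The crude bound with a common bound on both arguments. -/
lemma sum_rpow_mul_add_le_two {n : ℕ} {r β m : Fin n → ℝ} {μ γ a b d : ℝ} (hr : ∀ i, 0 < r i)
    (hμ : 0 < μ) (hγ : ∀ i, 2 * r i ≤ γ) (hm : ∀ i, 0 < m i) (hβ : ∀ i, 0 < β i)
    (ha : 0 ≤ a) (hb : 0 ≤ b) (had : a ≤ d) (hbd : b ≤ d) :
    ∑ i, β i * m i * (a ^ (γ - r i) * (a ^ (μ + r i) + b ^ (μ + r i)))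
      ≤ 2 * (∑ i, β i * m i) * d ^ (γ + μ) := by
  rw [mul_assoc, Finset.sum_mul, Finset.mul_sum]
  refine Finset.sum_le_sum fun i _ => ?_
  have hi := hr i
  have hγi := hγ i
  have h1 : 0 ≤ γ - r i := by linarith
  have h2 : 0 ≤ μ + r i := by linarith
  have hd : 0 ≤ d := ha.trans had
  have h3 : d ^ (γ - r i) * d ^ (μ + r i) = d ^ (γ + μ) := by
    rw [← Real.rpow_add_of_nonneg hd h1 h2]
    congr 1
    ring
  have h4 := mul_pos (hβ i) (hm i)
  calc _ ≤ β i * m i * (d ^ (γ - r i) * (d ^ (μ + r i) + d ^ (μ + r i))) := by gcongr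
    _ = _ := by rw [← h3]; ring

/-- A solution extended to the left by a constant. -/
lemma IsSol.exists_extension {n : ℕ} {h : ℝ} (hh : 0 < h)
    {f : (Fin n → ℝ) → (Fin n → ℝ) → (Fin n → ℝ)} {x : ℝ → Fin n → ℝ} (hx : IsSol n h f x) :
    ∃ X : ℝ → Fin n → ℝ, Continuous X ∧ (∀ t, -h ≤ t → X t = x t) ∧
      ∀ t, 0 < t → HasDerivAt X (f (X t) (X (t - h))) t := by
  have he : ∀ t, -h ≤ t → x (max t (-h)) = x t := fun t ht => by rw [max_eq_left ht]
  refine ⟨fun t => x (max t (-h)), ?_, he, fun t ht => ?_⟩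
  · exact hx.1.comp_continuous (by fun_prop) fun t => Set.mem_Ici.2 (le_max_right _ _)
  · simp only [he t (by linarith), he (t - h) (by linarith)]
    refine ((hx.2 t ht.le).hasDerivAt (Ici_mem_nhds ht)).congr_of_eventuallyEq ?_
    filter_upwards [Ici_mem_nhds (show -h < t by linarith)] with s hs using he s hs

lemma hnorm_lt_of_segNorm_lt {n : ℕ} {r : Fin n → ℝ} (hr : ∀ i, 0 < r i) {p h Δ : ℝ} (hp : 0 < p)
    {x : ℝ → Fin n → ℝ} (hx : ContinuousOn x (Set.Ici (-h))) (hΔ : segNorm n r p h x 0 < Δ)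
    {t : ℝ} (ht : -h ≤ t) (ht0 : t ≤ 0) : hnorm n r p (x t) < Δ := by
  unfold segNorm at hΔ
  have hmem : hnorm n r p (x t) ∈ (fun θ => hnorm n r p (x (0 + θ))) '' Set.Icc (-h) 0 :=
    ⟨t, ⟨ht, ht0⟩, by simp⟩
  refine lt_of_le_of_lt (le_csSup ?_ hmem) hΔ
  refine (isCompact_Icc.image_of_continuousOn ?_).bddAbove
  refine (continuous_hnorm n hr hp).comp_continuousOn ?_
  simp only [zero_add]
  exact hx.mono Set.Icc_subset_Ici_self

/-- If a continuous function cannot reach a level `M` for the first time, it stays below it. -/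
lemma lt_of_no_first_hit {v : ℝ → ℝ} {M : ℝ} (hv : ContinuousOn v (Set.Ici 0))
    (H : ∀ T, 0 ≤ T → (∀ s, 0 ≤ s → s < T → v s < M) → v T < M) (t : ℝ) (ht : 0 ≤ t) :
    v t < M := by
  by_contra! hcon
  have hc : IsCompact (Set.Icc 0 t ∩ v ⁻¹' Set.Ici M) :=
    isCompact_Icc.of_isClosed_subset
      ((hv.mono Set.Icc_subset_Ici_self).preimage_isClosed_of_isClosed isClosed_Icc isClosed_Ici)
      Set.inter_subset_left
  obtain ⟨T, ⟨hT, hTM⟩, hmin⟩ := hc.exists_isLeast ⟨t, ⟨ht, le_rfl⟩, hcon⟩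
  refine (H T hT.1 fun s hs hsT => ?_).not_ge hTM
  by_contra! hsM
  exact (hmin ⟨⟨hs, hsT.le.trans hT.2⟩, hsM⟩).not_gt hsT

theorem stmt8
    (n : ℕ) (hn : 1 ≤ n) (r : Fin n → ℝ) (hr : ∀ i, 0 < r i) (p : ℝ) (hp : 1 ≤ p)
    (h μ : ℝ) (hh : 0 < h) (hμ : 0 < μ)
    (f : (Fin n → ℝ) → (Fin n → ℝ) → (Fin n → ℝ))
    (hf_cd : ∀ y : Fin n → ℝ, ContDiff ℝ 1 fun x => f x y)
    (hf_lip : ∀ x : Fin n → ℝ, LocallyLipschitz fun y => f x y)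
    (hf_hom : ∀ ε : ℝ, 0 < ε → ∀ x y : Fin n → ℝ, ∀ i,
      f (fun k => ε ^ r k * x k) (fun k => ε ^ r k * y k) i = ε ^ (μ + r i) * f x y i)
    (m : Fin n → ℝ) (hm : ∀ i, 0 < m i)
    (hfm : ∀ x y : Fin n → ℝ, ∀ i,
      |f x y i| ≤ m i * (hnorm n r p x ^ (μ + r i) + hnorm n r p y ^ (μ + r i)))
    (η : Fin n → Fin n → ℝ) (hη : ∀ i j, 0 < η i j)
    (hfd1 : ∀ i j, 0 ≤ μ + r i - r j → ∀ x y : Fin n → ℝ,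
      |pd n f i j x y| ≤ η i j * (hnorm n r p x ^ (μ + r i - r j) + hnorm n r p y ^ (μ + r i - r j)))
    (hfd2 : ∀ i j, μ + r i - r j < 0 → ∀ x y : Fin n → ℝ, |pd n f i j x y| ≤ η i j)
    (V : (Fin n → ℝ) → ℝ) (hV : ContDiff ℝ 2 V)
    (α0 α1 γ : ℝ) (hα0 : 0 < α0) (hα1 : 0 < α1) (hγ : ∀ i, 2 * r i ≤ γ)
    (hVlb : ∀ x : Fin n → ℝ, α0 * hnorm n r p x ^ γ ≤ V x)
    (hVub : ∀ x : Fin n → ℝ, V x ≤ α1 * hnorm n r p x ^ γ)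
    (β : Fin n → ℝ) (hβ : ∀ i, 0 < β i)
    (hVd : ∀ x : Fin n → ℝ, ∀ i,
      |fderiv ℝ V x (Pi.single i 1)| ≤ β i * hnorm n r p x ^ (γ - r i))
    (ψ : Fin n → Fin n → ℝ) (hψ : ∀ i j, 0 < ψ i j)
    (hVdd : ∀ x : Fin n → ℝ, ∀ i j,
      |fderiv ℝ (fun z => fderiv ℝ V z (Pi.single i 1)) x (Pi.single j 1)|
        ≤ ψ i j * hnorm n r p x ^ (γ - r i - r j))
    (w : ℝ) (hw : 0 < w)
    (hVf : ∀ x : Fin n → ℝ, fderiv ℝ V x (f x x) ≤ -w * hnorm n r p x ^ (γ + μ))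
    (w1 w2 : ℝ) (hw1 : 0 < w1) (hw2 : 0 < w2) (hw0 : 0 < w - w1 - h * w2)
    (χ : ℝ) (hχ : 0 < χ)
    (a2 : ℝ) (ha2def : a2 = w1 - ∑ i, β i * m i * χ ^ (2 * (γ - r i))) (ha2 : 0 < a2)
    (H1 : ℝ) (hH1def : H1 = (α0 / (h * ∑ i, β i * m i * (1 + χ ^ (-2 * (μ + r i))))) ^ (1 / μ))
    (δ : ℝ) (hδ0 : 0 < δ) (hδH1 : δ < H1)
    (L : ℝ) (hLdef : L = ∑ i, ∑ j, m j * (β i * η i j *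
      (if 0 ≤ μ + r i - r j then 1 else δ ^ (r j - r i - μ)) + m i * ψ i j))
    (H2 : ℝ) (hH2def : H2 = (min ((w - w1 - h * w2) / (4 * h * L))
      (min (w1 / (2 * h * L)) (w2 / (2 * L)))) ^ (1 / μ))
    (hδH2 : δ < H2)
    (a1 : ℝ) (ha1def : a1 = α0 - h * (∑ i, β i * m i * (1 + χ ^ (-2 * (μ + r i)))) * δ ^ μ)
    (b3 : ℝ) (hb3def : b3 = (w1 + h * w2 + 2 * h * ∑ i, β i * m i) * h)
    (Δ : ℝ) (hΔ : 0 < Δ) (hroot : α1 * Δ ^ γ + b3 * Δ ^ (γ + μ) = a1 * δ ^ γ) :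
    ∀ x : ℝ → Fin n → ℝ, IsSol n h f x → segNorm n r p h x 0 < Δ →
      Filter.Tendsto (fun t => hnorm n r p (x t)) Filter.atTop (nhds 0) := by
  intro x hx hxΔ
  obtain ⟨X, hXc, hXx, hXd⟩ := hx.exists_extension hh
  have hp0 : 0 < p := by linarith
  have hXΔ : ∀ t, -h ≤ t → t ≤ 0 → hnorm n r p (X t) < Δ := fun t ht ht0 => by
    rw [hXx t ht]
    exact hnorm_lt_of_segNorm_lt hr hp0 hx.1 hxΔ ht ht0
  suffices H : Filter.Tendsto (fun t => hnorm n r p (X t)) Filter.atTop (nhds 0) by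
    refine H.congr' ?_
    filter_upwards [Filter.eventually_ge_atTop (-h)] with t ht
    rw [hXx t ht]
  have hnc := (continuous_hnorm n hr hp0).comp hXc
  have i0 : Fin n := ⟨0, hn⟩
  have : Nonempty (Fin n) := ⟨i0⟩
  have hγ0 : 0 < γ := by linarith [hγ i0, hr i0]
  have hA0 : 0 < γ + μ := by linarith
  -- the running quantities
  set ρ : ℝ → ℝ := fun t => hnorm n r p (X t) ^ (γ + μ) with hρdef
  set v : ℝ → ℝ := fun t => V (X t) with hvdef
  set g : ℝ → ℝ := fun t => fderiv ℝ V (X t) (f (X t) (X (t - h))) with hgdef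
  have hρ : Continuous ρ := hnc.rpow_const fun _ => Or.inr hA0.le
  have hρ0 : ∀ t, 0 ≤ ρ t := fun t => Real.rpow_nonneg (hnorm_nonneg _ _ _ _) _
  have hv : Continuous v := hV.continuous.comp hXc
  have hv0 : ∀ t, 0 ≤ v t := fun t =>
    (mul_nonneg hα0.le (Real.rpow_nonneg (hnorm_nonneg _ _ _ _) _)).trans (hVlb (X t))
  have hg : ∀ t, 0 < t → HasDerivAt v (g t) t := fun t ht =>
    ((hV.differentiable (by norm_num)) (X t)).hasFDerivAt.comp_hasDerivAt t (hXd t ht)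
  -- the constants
  set S := ∑ i, β i * m i with hSdef
  set Yc := ∑ i, β i * m i * χ ^ (-2 * (μ + r i)) with hYdef
  set Xc := ∑ i, β i * m i * χ ^ (2 * (γ - r i)) with hXcdef
  have hS0 : 0 < S := Finset.sum_pos (fun i _ => mul_pos (hβ i) (hm i)) Finset.univ_nonempty
  have hY0 : 0 < Yc := Finset.sum_pos
    (fun i _ => mul_pos (mul_pos (hβ i) (hm i)) (Real.rpow_pos_of_pos hχ _)) Finset.univ_nonempty
  have hX0 : 0 < Xc := Finset.sum_pos
    (fun i _ => mul_pos (mul_pos (hβ i) (hm i)) (Real.rpow_pos_of_pos hχ _)) Finset.univ_nonempty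
  have hSY : ∑ i, β i * m i * (1 + χ ^ (-2 * (μ + r i))) = S + Yc := by
    simp only [mul_add, mul_one, Finset.sum_add_distrib, hSdef, hYdef]
  rw [hSY] at ha1def
  have hL0 : 0 < L := by
    rw [hLdef]
    refine Finset.sum_pos (fun i _ => Finset.sum_pos (fun j _ => ?_) Finset.univ_nonempty)
      Finset.univ_nonempty
    have hmi := hm i
    have hmj := hm j
    have hβi := hβ i
    have hηij := hη i j
    have hψij := hψ i j
    have : (0 : ℝ) < if 0 ≤ μ + r i - r j then 1 else δ ^ (r j - r i - μ) := by
      split_ifs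
      · exact one_pos
      · positivity
    positivity
  have hδμ0 : 0 < δ ^ μ := Real.rpow_pos_of_pos hδ0 _
  set E := L * δ ^ μ with hEdef
  have hE0 : 0 < E := mul_pos hL0 hδμ0
  have hδmin : δ ^ μ < min ((w - w1 - h * w2) / (4 * h * L))
      (min (w1 / (2 * h * L)) (w2 / (2 * L))) := by
    have hpos : 0 ≤ min ((w - w1 - h * w2) / (4 * h * L))
        (min (w1 / (2 * h * L)) (w2 / (2 * L))) := by positivity
    have := Real.rpow_lt_rpow hδ0.le hδH2 hμ
    rwa [hH2def, ← Real.rpow_mul hpos, one_div_mul_cancel hμ.ne', Real.rpow_one] at this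
  obtain ⟨hd1, hd2, hd3⟩ := (lt_min_iff.1 hδmin).imp_right lt_min_iff.1
  have hE1 : 4 * h * E < w - w1 - h * w2 := by
    rw [lt_div_iff₀ (by positivity)] at hd1
    linarith
  have hE2 : 2 * h * E < w1 := by
    rw [lt_div_iff₀ (by positivity)] at hd2
    linarith
  have hE3 : 2 * E < w2 := by
    rw [lt_div_iff₀ (by positivity)] at hd3
    linarith
  have hE4 : 8 * h * E < w := by
    have := mul_lt_mul_of_pos_left hE3 hh
    linarith
  set Q := δ ^ (γ + μ) with hQdef
  set q := Δ ^ (γ + μ) with hqdef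
  have hQ0 : 0 < Q := Real.rpow_pos_of_pos hδ0 _
  have hq0 : 0 < q := Real.rpow_pos_of_pos hΔ _
  have hQe : δ ^ μ * δ ^ γ = Q := by rw [hQdef, Real.rpow_add hδ0, mul_comm]
  have hone := hnorm_one_pos hn r p
  have hwS : w ≤ 2 * S := by
    have h1 := abs_fderiv_apply_le hm hfm hVd (fun _ : Fin n => (1 : ℝ)) (fun _ => 1)
    have h2 := sum_rpow_mul_add_le_two hr hμ hγ hm hβ hone.le hone.le le_rfl le_rfl
    have h3 := hVf (fun _ => 1)
    have h4 := neg_abs_le (fderiv ℝ V (fun _ => 1) (f (fun _ => 1) (fun _ => 1)))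
    refine le_of_mul_le_mul_right ?_ (Real.rpow_pos_of_pos hone (γ + μ))
    linarith
  have hSE : 4 * h * E ≤ S := by linarith
  have hα : α0 ≤ α1 :=
    le_of_mul_le_mul_right ((hVlb _).trans (hVub _)) (Real.rpow_pos_of_pos hone γ)
  have hb3 : b3 * q = (w1 * h + w2 * h ^ 2 + 2 * S * h ^ 2) * q := by
    rw [hb3def]
    ring
  have hroot' : α1 * Δ ^ γ + b3 * q = α0 * δ ^ γ - h * (S + Yc) * Q := by
    rw [hroot, ha1def, ← hQe]
    ring
  have hb30 : 0 < b3 * q := by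
    rw [hb3]
    positivity
  have hΔδ : Δ < δ := by
    have h1 : 0 < h * (S + Yc) * Q := by positivity
    have h2 := mul_le_mul_of_nonneg_right hα (Real.rpow_nonneg hδ0.le γ)
    exact lt_of_mul_lt_mul_left (show α1 * Δ ^ γ < α1 * δ ^ γ by linarith) hα1.le
      |> (Real.rpow_lt_rpow_iff hΔ.le hδ0.le hγ0).1
  have hv00 : v 0 ≤ α1 * Δ ^ γ := by
    refine (hVub _).trans (mul_le_mul_of_nonneg_left ?_ hα1.le)
    exact Real.rpow_le_rpow (hnorm_nonneg _ _ _ _) (hXΔ 0 (by linarith) le_rfl).le hγ0.le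
  have hbudget : v 0 + h * (S * Q + (Yc * Q + Xc * q)) + E * h ^ 2 * q < α0 * δ ^ γ := by
    have h1 : 0 < (w1 - Xc) * (h * q) := mul_pos (by linarith) (by positivity)
    have h2 : 0 < (w2 - E) * (h ^ 2 * q) := mul_pos (by linarith) (by positivity)
    have h3 : 0 < 2 * S * h ^ 2 * q := by positivity
    linarith
  -- differential inequalities
  have hρq : ∀ t, -h ≤ t → t ≤ 0 → ρ t ≤ q := fun t ht ht0 =>
    Real.rpow_le_rpow (hnorm_nonneg _ _ _ _) (hXΔ t ht ht0).le hA0.le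
  have hearly : ∀ t, 0 < t → t ≤ h → hnorm n r p (X t) ≤ δ →
      g t ≤ S * ρ t + (Yc * Q + Xc * q) := fun t ht hth htδ =>
    (le_abs_self _).trans ((abs_fderiv_apply_le hm hfm hVd _ _).trans
      (sum_rpow_mul_add_le hr hμ hγ hm hβ hχ (hnorm_nonneg _ _ _ _) (hnorm_nonneg _ _ _ _)
        hδ0 hΔ htδ (hXΔ (t - h) (by linarith) (by linarith)).le))
  have hlate : ∀ t, h < t → (∀ s, -h ≤ s → s < t → hnorm n r p (X s) ≤ δ) →
      g t ≤ -w * ρ (t - h) + 2 * h * E * ρ (t - h)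
        + 4 * E * ((∫ s in (0 : ℝ)..t, ρ s) - ∫ s in (0 : ℝ)..(t - h), ρ s)
        + 2 * E * ((∫ s in (0 : ℝ)..(t - h), ρ s) - ∫ s in (0 : ℝ)..(t - 2 * h), ρ s) := by
    intro t ht hδt
    have hF := hasDerivAt_primitive hρ
    set F : ℝ → ℝ := fun t => ∫ s in (0 : ℝ)..t, ρ s
    have hder : ∀ s, 0 < s → HasDerivAt (fun s => fderiv ℝ V (X s) (f (X s) (X (t - h)))
        - E * (4 * F s + 2 * ρ (t - h) * s + 2 * F (s - h)))
        ((∑ i, ∑ j, f (X s) (X (s - h)) j * (fderiv ℝ V (X s) (Pi.single i 1)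
            * pd n f i j (X s) (X (t - h)) + f (X s) (X (t - h)) i
              * fderiv ℝ (fun z => fderiv ℝ V z (Pi.single i 1)) (X s) (Pi.single j 1)))
          - E * (4 * ρ s + 2 * ρ (t - h) * 1 + 2 * ρ (s - h))) s := fun s hs =>
      (hasDerivAt_fderiv_apply hf_cd hV _ (hXd s hs)).sub
        (((((hF s).const_mul 4).add ((hasDerivAt_id s).const_mul (2 * ρ (t - h)))).add
          (((hF (s - h)).comp_sub_const s h).const_mul 2)).const_mul E)
    have := le_of_hasDerivAt_nonpos (a := t - h) (b := t) (by linarith)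
      (fun s hs => (hder s (by linarith [hs.1])).continuousAt.continuousWithinAt)
      (fun s hs => hder s (by linarith [hs.1]))
      (fun s hs => by
        have := (le_abs_self _).trans (abs_second_order_le hr hμ hδ0 hm hfm hη hfd1 hfd2 hγ hβ
          hVd hψ hVdd (hδt s (by linarith [hs.1]) hs.2)
          (hδt (t - h) (by linarith) (by linarith)) (hδt (s - h) (by linarith [hs.1])
            (by linarith [hs.2])))
        rw [← hLdef] at this
        simp only [hρdef]
        linarith)
    have h0 := hVf (X (t - h))
    have e : t - h - h = t - 2 * h := by ring
    rw [e] at this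
    simp only [hgdef, hρdef] at this ⊢
    linarith
  -- solutions stay in the ball of radius `δ`
  have hδ_of : ∀ T, (∀ s, 0 ≤ s → s < T → v s < α0 * δ ^ γ) →
      ∀ t, -h ≤ t → t < T → hnorm n r p (X t) ≤ δ := by
    intro T hT t ht htT
    rcases le_total t 0 with h0 | h0
    · exact ((hXΔ t ht h0).trans hΔδ).le
    · have h1 := (hVlb (X t)).trans_lt (hT t h0 htT)
      exact ((Real.rpow_lt_rpow_iff (hnorm_nonneg _ _ _ _) hδ0.le hγ0).1
        (lt_of_mul_lt_mul_left h1 hα0.le)).le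
  have hbound : ∀ T, h ≤ T → (∀ t, -h ≤ t → t < T → hnorm n r p (X t) ≤ δ) →
      v T + (w - 8 * h * E) * (∫ s in (0 : ℝ)..(T - h), ρ s) < α0 * δ ^ γ := by
    intro T hT hb
    refine lt_of_le_of_lt (delay_bound hρ hρ0 hv.continuousOn hg hh hE0.le hSE hT
      (fun t ht htT => Real.rpow_le_rpow (hnorm_nonneg _ _ _ _) (hb t ht htT) hA0.le) hρq
      (fun t ht htT hth => hearly t ht hth (hb t (by linarith) htT))
      (fun t ht htT => hlate t ht fun s hs hst => hb s hs (hst.trans htT))) hbudget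
  have hstay : ∀ t, 0 ≤ t → v t < α0 * δ ^ γ := by
    refine lt_of_no_first_hit hv.continuousOn fun T hT hlt => ?_
    have hb := hδ_of T hlt
    rcases le_total T h with hTh | hTh
    · have h1 := delay_initial_bound hS0.le hv.continuousOn hg hT hTh
        (fun t ht htT => Real.rpow_le_rpow (hnorm_nonneg _ _ _ _) (hb t ht htT) hA0.le)
        (fun t ht htT hth => hearly t ht hth (hb t (by linarith) htT))
      have h2 : 0 ≤ S * Q + (Yc * Q + Xc * q) := by positivity
      have h3 := mul_le_mul_of_nonneg_right hTh h2
      have h4 : 0 < E * h ^ 2 * q := by positivity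
      linarith
    · have h1 := hbound T hTh hb
      have h2 : 0 ≤ ∫ s in (0 : ℝ)..(T - h), ρ s :=
        intervalIntegral.integral_nonneg (by linarith) fun s _ => hρ0 s
      have h3 := mul_nonneg (sub_nonneg.2 hE4.le) h2
      linarith
  have hball : ∀ t, -h ≤ t → hnorm n r p (X t) ≤ δ := fun t ht =>
    hδ_of (t + 1) (fun s hs _ => hstay s hs) t ht (by linarith)
  -- convergence
  have hvlim : Filter.Tendsto v Filter.atTop (nhds 0) := by
    refine tendsto_zero_of_integral_bounded (B := 2 * S * Q)
      (M := α0 * δ ^ γ / (w - 8 * h * E)) hρ hρ0 hv0 hg (by positivity) (fun t ht => ?_)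
      (fun t ht => ?_) (fun ε hε => ⟨(ε / α1) ^ ((γ + μ) / γ), by positivity, fun t _ hεt => ?_⟩)
    · exact (le_abs_self _).trans ((abs_fderiv_apply_le hm hfm hVd _ _).trans
        (sum_rpow_mul_add_le_two hr hμ hγ hm hβ (hnorm_nonneg _ _ _ _) (hnorm_nonneg _ _ _ _)
          (hball t (by linarith)) (hball (t - h) (by linarith))))
    · rw [le_div_iff₀ (by linarith)]
      have := hbound (t + h) (by linarith) fun s hs _ => hball s hs
      rw [add_sub_cancel_right] at this
      linarith [hv0 (t + h)]
    · have h1 : ε / α1 ≤ hnorm n r p (X t) ^ γ := by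
        rw [div_le_iff₀ hα1]
        linarith [hVub (X t)]
      calc (ε / α1) ^ ((γ + μ) / γ) ≤ (hnorm n r p (X t) ^ γ) ^ ((γ + μ) / γ) := by gcongr
        _ = ρ t := by
            rw [← Real.rpow_mul (hnorm_nonneg _ _ _ _), mul_div_cancel₀ _ hγ0.ne']
  have hpow : Filter.Tendsto (fun t => hnorm n r p (X t) ^ γ) Filter.atTop (nhds 0) := by
    refine squeeze_zero (fun t => Real.rpow_nonneg (hnorm_nonneg _ _ _ _) _)
      (fun t => ?_) (by simpa using hvlim.div_const α0)
    rw [le_div_iff₀ hα0, mul_comm]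
    exact hVlb (X t)
  have := hpow.rpow_const (p := 1 / γ) (Or.inr (by positivity))
  rw [Real.zero_rpow (by positivity)] at this
  refine this.congr fun t => ?_
  rw [← Real.rpow_mul (hnorm_nonneg _ _ _ _), mul_one_div_cancel hγ0.ne', Real.rpow_one]
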